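/- arXiv:2512.09778 — 6 statements merged into one kernel-verified Lean document; each statement's English description precedes it below -/
import Mathlib

section
/- Let N ≥ 1, let H be an N×N Hermitian complex matrix with eigenvalues λ_1, …, λ_N listed with multiplicity, let ε > 0 and d > 0, and suppose that the number of ordered pairs (j,k) ∈ {1,…,N}² with |λ_j − λ_k| ≥ ε is at least d·N². Define I(t) = (1/N²) · Σ_{j,k} cos((λ_j − λ_k)·t). Then the Lebesgue measure of the set {t ∈ [0, 2/ε] : I(t) ≤ 1 − d/4} is at least (1/3)·(2/ε). -/
open MeasureTheory Classical

lemma scm_of_majorant (L s : ℝ) (f g : ℝ → ℝ) (hs : s ≤ 3 / 4) (hL : 0 ≤ L)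
    (hf : Continuous f) (hg0 : ∀ t ∈ Set.Icc 0 L, 0 ≤ g t)
    (hfg : ∀ t ∈ Set.Icc 0 L, f t - s ≤ g t)
    (hgi : IntegrableOn g (Set.Icc 0 L))
    (hg : ∫ t in Set.Icc 0 L, g t ≤ (3 / 4 - s) * (2 * L / 3))
    (B : Set ℝ) (hB : B ⊆ Set.Icc 0 L) (hBm : MeasurableSet B)
    (hBv : 2 * L / 3 ≤ volume.real B) :
    ∫ t in B, f t ≤ 3 / 4 * volume.real B := by
  have hBfin : volume B ≠ ⊤ := ((measure_mono hB).trans_lt (by simp)).ne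
  have hfi : IntegrableOn f B := (hf.integrableOn_Icc (a := 0) (b := L)).mono_set hB
  have hci : IntegrableOn (fun _ : ℝ => s) B := integrableOn_const hBfin
  have h1 : ∫ t in B, (f t - s) ≤ ∫ t in B, g t :=
    setIntegral_mono_on (hfi.sub hci) (hgi.mono_set hB) hBm (fun t ht => hfg t (hB ht))
  have h2 : ∫ t in B, g t ≤ ∫ t in Set.Icc 0 L, g t := by
    apply setIntegral_mono_set hgi
    · exact (ae_restrict_iff' measurableSet_Icc).2 (Filter.Eventually.of_forall hg0)
    · exact hB.eventuallyLE
  rw [integral_sub hfi hci, setIntegral_const, smul_eq_mul] at h1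
  nlinarith

lemma scm_cos_pos (ε x : ℝ) (hε : 0 < ε) (hx : ε ≤ x)
    (B : Set ℝ) (hB : B ⊆ Set.Icc 0 (2 / ε)) (hBm : MeasurableSet B)
    (hBv : 2 * (2 / ε) / 3 ≤ volume.real B) :
    ∫ t in B, Real.cos (x * t) ≤ 3 / 4 * volume.real B := by
  have hx0 : 0 < x := hε.trans_le hx
  have hL : 0 < 2 / ε := by positivity
  have hT : 2 ≤ x * (2 / ε) := by
    rw [mul_div_assoc', le_div_iff₀ hε]; linarith
  have hpi := Real.pi_gt_d2
  set L := 2 / ε with hLdef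
  by_cases hc : x * L ≤ 4.4
  · -- small range
    have hcos : Real.cos (4 / 3) ≤ 3 / 4 := by
      have h1 : Real.cos (4 / 3) ≤ Real.cos 1 :=
        Real.cos_le_cos_of_nonneg_of_le_pi (by norm_num) (by linarith) (by norm_num)
      have := Real.cos_one_le
      linarith
    have ha : 4 / 3 / x ≤ L := by
      rw [div_le_iff₀ hx0]; linarith
    have ha0 : 0 ≤ 4 / 3 / x := by positivity
    refine scm_of_majorant L (Real.cos (4 / 3)) _
      ((Set.Icc 0 (4 / 3 / x)).indicator (fun t => Real.cos (x * t) - Real.cos (4 / 3)))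
      hcos hL.le (by fun_prop) ?_ ?_ ?_ ?_ B hB hBm hBv
    · intro t ht
      apply Set.indicator_nonneg
      rintro t ⟨h0, h1⟩
      rw [le_div_iff₀ hx0] at h1
      have := Real.cos_le_cos_of_nonneg_of_le_pi (x := x * t) (y := 4 / 3)
        (by positivity) (by linarith) (by linarith)
      linarith
    · intro t ht
      by_cases hm : t ∈ Set.Icc 0 (4 / 3 / x)
      · rw [Set.indicator_of_mem hm]
      · rw [Set.indicator_of_notMem hm]
        have h1 : 4 / 3 < x * t := by
          by_contra hh
          apply hm
          refine ⟨ht.1, ?_⟩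
          rw [le_div_iff₀ hx0]; linarith
        have h2 : x * t ≤ 4.4 := (mul_le_mul_of_nonneg_left ht.2 hx0.le).trans hc
        rcases le_total (x * t) Real.pi with h3 | h3
        · have := Real.cos_le_cos_of_nonneg_of_le_pi (x := 4 / 3) (y := x * t)
            (by norm_num) h3 h1.le
          linarith
        · have := Real.cos_le_cos_of_nonneg_of_le_pi (x := 4 / 3) (y := 2 * Real.pi - x * t)
            (by norm_num) (by linarith) (by norm_num at h2; linarith)
          rw [Real.cos_two_pi_sub] at this
          linarith
    · apply IntegrableOn.indicator _ measurableSet_Icc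
      exact Continuous.integrableOn_Icc (by fun_prop)
    · rw [setIntegral_indicator measurableSet_Icc,
        Set.inter_eq_self_of_subset_right (Set.Icc_subset_Icc le_rfl ha),
        integral_Icc_eq_integral_Ioc, ← intervalIntegral.integral_of_le ha0,
        intervalIntegral.integral_sub (Continuous.intervalIntegrable (by fun_prop) _ _)
          (Continuous.intervalIntegrable (by fun_prop) _ _),
        intervalIntegral.integral_comp_mul_left (fun u => Real.cos u) hx0.ne',
        integral_cos, intervalIntegral.integral_const]
      have e : x * (4 / 3 / x) = 4 / 3 := by field_simp
      rw [e]
      simp only [mul_zero, Real.sin_zero, sub_zero, smul_eq_mul]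
      have hs := Real.sin_le_one (4 / 3)
      have h1 : x⁻¹ * Real.sin (4 / 3) - 4 / 3 / x * Real.cos (4 / 3)
          ≤ (3 / 4 - Real.cos (4 / 3)) * (4 / 3 / x) := by
        have : x⁻¹ * Real.sin (4 / 3) ≤ x⁻¹ * 1 :=
          mul_le_mul_of_nonneg_left hs (by positivity)
        have e2 : (3 / 4 - Real.cos (4 / 3)) * (4 / 3 / x)
          = x⁻¹ * 1 - 4 / 3 / x * Real.cos (4 / 3) := by field_simp
        linarith
      refine h1.trans (mul_le_mul_of_nonneg_left ?_ (by linarith))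
      rw [div_le_iff₀ hx0]; linarith
  · push Not at hc
    refine scm_of_majorant L (1 / 8) _
      (fun t => 2 / 5 * (Real.cos (x * t) + 1 / 2) ^ 2)
      (by norm_num) hL.le (by fun_prop) ?_ ?_ ?_ ?_ B hB hBm hBv
    · intro t ht; positivity
    · intro t ht
      nlinarith [sq_nonneg (Real.cos (x * t) - 3 / 4)]
    · exact Continuous.integrableOn_Icc (by fun_prop)
    · rw [integral_Icc_eq_integral_Ioc, ← intervalIntegral.integral_of_le hL.le,
        intervalIntegral.integral_comp_mul_left
          (fun u => 2 / 5 * (Real.cos u + 1 / 2) ^ 2) hx0.ne']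
      have hI : ∫ u in (x * 0)..(x * L), 2 / 5 * (Real.cos u + 1 / 2) ^ 2
          = 2 / 5 * (3 / 4 * (x * L) + Real.cos (x * L) * Real.sin (x * L) / 2
            + Real.sin (x * L)) := by
        have hd : ∀ u : ℝ, HasDerivAt (fun u => 2 / 5 * (3 / 4 * u
            + Real.cos u * Real.sin u / 2 + Real.sin u))
            (2 / 5 * (Real.cos u + 1 / 2) ^ 2) u := by
          intro u
          have := (((((hasDerivAt_id u).const_mul (3 / 4)).add
            (((Real.hasDerivAt_cos u).mul (Real.hasDerivAt_sin u)).div_const 2)).add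
            (Real.hasDerivAt_sin u)).const_mul (2 / 5))
          refine HasDerivAt.congr_deriv this ?_
          have := Real.sin_sq_add_cos_sq u
          linear_combination (-1 / 5 : ℝ) * this
        rw [intervalIntegral.integral_eq_sub_of_hasDerivAt (fun u _ => hd u)
          (Continuous.intervalIntegrable (by fun_prop) _ _)]
        simp
      rw [hI, smul_eq_mul, inv_mul_le_iff₀ hx0]
      have h1 := Real.sin_le_one (x * L)
      have h2 : Real.cos (x * L) * Real.sin (x * L) ≤ 1 / 2 := by
        nlinarith [Real.sin_sq_add_cos_sq (x * L),
          sq_nonneg (Real.cos (x * L) - Real.sin (x * L))]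
      norm_num at hc
      nlinarith

lemma scm_cos (ε x : ℝ) (hε : 0 < ε) (hx : ε ≤ |x|)
    (B : Set ℝ) (hB : B ⊆ Set.Icc 0 (2 / ε)) (hBm : MeasurableSet B)
    (hBv : 2 * (2 / ε) / 3 ≤ volume.real B) :
    ∫ t in B, Real.cos (x * t) ≤ 3 / 4 * volume.real B := by
  have := scm_cos_pos ε |x| hε hx B hB hBm hBv
  rcases abs_choice x with h | h <;> rw [h] at this
  · exact this
  · simpa only [neg_mul, Real.cos_neg] using this

/-- **Sufficient spectral condition.** If at least a proportion `d` of the ordered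
eigenvalue pairs of a Hermitian matrix `H` are separated by at least `ε`, then the
set of times `t ∈ [0, 2/ε]` at which the Bell-sampling identity-outcome probability
`I(t) = (1/N²) ∑_{j,k} cos((λ_j − λ_k) t)` drops below `1 − d/4` has Lebesgue
measure at least `(1/3)·(2/ε)`. -/
theorem spectral_condition_measure
    (N : ℕ) (hN : 1 ≤ N) (H : Matrix (Fin N) (Fin N) ℂ) (hH : H.IsHermitian)
    (ε d : ℝ) (hε : 0 < ε) (hd : 0 < d)
    (hgap : d * (N : ℝ) ^ 2 ≤
      ((Finset.univ.filter (fun jk : Fin N × Fin N =>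
        ε ≤ |hH.eigenvalues jk.1 - hH.eigenvalues jk.2|)).card : ℝ)) :
    ENNReal.ofReal ((1 / 3) * (2 / ε)) ≤
      volume {t ∈ Set.Icc (0 : ℝ) (2 / ε) |
        (1 / (N : ℝ) ^ 2) * ∑ j : Fin N, ∑ k : Fin N,
            Real.cos ((hH.eigenvalues j - hH.eigenvalues k) * t) ≤ 1 - d / 4} := by
  set F : ℝ → ℝ := fun t => (1 / (N : ℝ) ^ 2) * ∑ j : Fin N, ∑ k : Fin N,
            Real.cos ((hH.eigenvalues j - hH.eigenvalues k) * t) with hF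
  have hFc : Continuous F := by fun_prop
  change _ ≤ volume {t ∈ Set.Icc (0 : ℝ) (2 / ε) | F t ≤ 1 - d / 4}
  set G := {t ∈ Set.Icc (0 : ℝ) (2 / ε) | F t ≤ 1 - d / 4} with hG
  have hL : 0 < 2 / ε := by positivity
  have hGm : MeasurableSet G :=
    measurableSet_Icc.inter (measurableSet_le hFc.measurable measurable_const)
  have hGs : G ⊆ Set.Icc 0 (2 / ε) := fun t ht => ht.1
  have hGfin : volume G ≠ ⊤ := ((measure_mono hGs).trans_lt (by simp)).ne
  by_contra hcon
  push Not at hcon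
  have hGv : volume.real G < (1 / 3) * (2 / ε) := by
    rw [measureReal_def]
    exact (ENNReal.lt_ofReal_iff_toReal_lt hGfin).1 hcon
  set B := Set.Icc 0 (2 / ε) \ G with hBdef
  have hBs : B ⊆ Set.Icc 0 (2 / ε) := Set.sdiff_subset
  have hBm : MeasurableSet B := measurableSet_Icc.diff hGm
  have hBfin : volume B ≠ ⊤ := ((measure_mono hBs).trans_lt (by simp)).ne
  have hBv : 2 * (2 / ε) / 3 ≤ volume.real B := by
    have h1 : volume.real B = volume.real (Set.Icc 0 (2 / ε)) - volume.real G :=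
      measureReal_sdiff hGs hGm (by simp)
    rw [h1, Real.volume_real_Icc_of_le hL.le]
    linarith
  have hBpos : 0 < volume.real B := by linarith [show 0 < 2 * (2 / ε) / 3 by positivity]
  have hB0 : volume B ≠ 0 := by
    intro h
    rw [measureReal_def, h] at hBpos
    simp at hBpos
  have hFi : IntegrableOn F B := (hFc.integrableOn_Icc (a := 0) (b := 2 / ε)).mono_set hBs
  obtain ⟨t, htB, ht⟩ := exists_le_setAverage hB0 hBfin hFi
  have hNpos : (0 : ℝ) < (N : ℝ) ^ 2 := by positivity
  have hci : ∀ x : ℝ, IntegrableOn (fun t => Real.cos (x * t)) B := fun x =>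
    (Continuous.integrableOn_Icc (a := 0) (b := 2 / ε) (by fun_prop)).mono_set hBs
  have hint : ∫ t in B, F t = (1 / (N : ℝ) ^ 2) * ∑ jk : Fin N × Fin N,
      ∫ t in B, Real.cos ((hH.eigenvalues jk.1 - hH.eigenvalues jk.2) * t) := by
    rw [← integral_finsetSum _ (fun jk _ => hci _), ← integral_const_mul]
    simp only [hF, Fintype.sum_prod_type]
  have hsum : ∑ jk : Fin N × Fin N,
      ∫ t in B, Real.cos ((hH.eigenvalues jk.1 - hH.eigenvalues jk.2) * t)
      ≤ ∑ jk : Fin N × Fin N, (volume.real B - (volume.real B / 4) *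
        (if ε ≤ |hH.eigenvalues jk.1 - hH.eigenvalues jk.2| then 1 else 0)) := by
    apply Finset.sum_le_sum
    intro jk _
    split_ifs with h
    · have := scm_cos ε _ hε h B hBs hBm hBv
      linarith
    · have h1 : ∫ t in B, Real.cos ((hH.eigenvalues jk.1 - hH.eigenvalues jk.2) * t)
          ≤ ∫ t in B, (1 : ℝ) :=
        setIntegral_mono_on (hci _) (integrableOn_const hBfin) hBm
          (fun t _ => Real.cos_le_one _)
      rw [setIntegral_const, smul_eq_mul] at h1
      linarith
  rw [Finset.sum_sub_distrib, ← Finset.mul_sum, Finset.sum_boole] at hsum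
  simp only [Finset.sum_const, Finset.card_univ, Fintype.card_prod, Fintype.card_fin,
    nsmul_eq_mul, Nat.cast_mul] at hsum
  have hle : ∫ t in B, F t ≤ (1 - d / 4) * volume.real B := by
    rw [hint, one_div, inv_mul_le_iff₀ hNpos]
    refine hsum.trans ?_
    have := mul_le_mul_of_nonneg_left hgap (show 0 ≤ volume.real B / 4 by positivity)
    nlinarith
  have havg : (⨍ t in B, F t) ≤ 1 - d / 4 := by
    rw [setAverage_eq, smul_eq_mul, inv_mul_le_iff₀ hBpos]
    linarith
  exact htB.2 ⟨htB.1, ht.trans havg⟩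
end

section
/- Let N ≥ 1, let H be an N×N Hermitian complex matrix with eigenvalues λ_1, …, λ_N listed with multiplicity, let ε > 0 and d ∈ [0,1], and suppose that the number of ordered pairs (j,k) ∈ {1,…,N}² with |λ_j − λ_k| ≥ ε is at least d·N². Then the average over t uniform in [0, 2/ε] of I(t) = (1/N²)·Σ_{j,k} cos((λ_j − λ_k)·t) satisfies (ε/2)·∫_0^{2/ε} I(t) dt ≤ 1 − d/2. -/
open MeasureTheory Classical

lemma avg_cos_le (ε a : ℝ) (hε : 0 < ε) :
    (∫ t in Set.Icc (0 : ℝ) (2 / ε), Real.cos (a * t)) ≤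
      (2 / ε) * (1 - if ε ≤ |a| then (1 / 2 : ℝ) else 0) := by
  have h2 : (0 : ℝ) ≤ 2 / ε := by positivity
  rw [integral_Icc_eq_integral_Ioc, ← intervalIntegral.integral_of_le h2]
  split_ifs with h
  · have ha : 0 < |a| := lt_of_lt_of_le hε h
    have ha0 : a ≠ 0 := abs_pos.mp ha
    rw [intervalIntegral.integral_comp_mul_left (fun x => Real.cos x) ha0, integral_cos]
    simp only [mul_zero, Real.sin_zero, sub_zero, smul_eq_mul]
    refine (le_abs_self _).trans ?_
    rw [abs_mul, abs_inv]
    have h1 := Real.abs_sin_le_one (a * (2 / ε))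
    have h3 : |a|⁻¹ ≤ ε⁻¹ := inv_anti₀ hε h
    calc |a|⁻¹ * |Real.sin (a * (2 / ε))| ≤ ε⁻¹ * 1 := by gcongr
      _ = _ := by field_simp; norm_num
  · have : (∫ t in (0 : ℝ)..(2 / ε), Real.cos (a * t)) ≤ ∫ t in (0 : ℝ)..(2 / ε), (1 : ℝ) := by
      apply intervalIntegral.integral_mono_on h2
      · exact Continuous.intervalIntegrable (by fun_prop) _ _
      · exact Continuous.intervalIntegrable (by fun_prop) _ _
      · intro x _
        exact Real.cos_le_one _
    simpa using this


/-- If at least a proportion `d ∈ [0,1]` of the ordered eigenvalue pairs of a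
Hermitian matrix `H` are separated by at least `ε`, then the average over
`t` uniform in `[0, 2/ε]` of the Bell-sampling identity-outcome probability
`I(t) = (1/N²) ∑_{j,k} cos((λ_j − λ_k) t)` is at most `1 − d/2`. -/
theorem avg_identity_probability_le
    (N : ℕ) (hN : 1 ≤ N) (H : Matrix (Fin N) (Fin N) ℂ) (hH : H.IsHermitian)
    (ε d : ℝ) (hε : 0 < ε) (hd : d ∈ Set.Icc (0 : ℝ) 1)
    (hgap : d * (N : ℝ) ^ 2 ≤
      ((Finset.univ.filter (fun jk : Fin N × Fin N =>
        ε ≤ |hH.eigenvalues jk.1 - hH.eigenvalues jk.2|)).card : ℝ)) :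
    (ε / 2) * (∫ t in Set.Icc (0 : ℝ) (2 / ε),
        (1 / (N : ℝ) ^ 2) * ∑ j : Fin N, ∑ k : Fin N,
          Real.cos ((hH.eigenvalues j - hH.eigenvalues k) * t)) ≤ 1 - d / 2 := by
  have hN0 : (0 : ℝ) < (N : ℝ) ^ 2 := by
    have : (0 : ℝ) < N := by exact_mod_cast hN
    positivity
  have hint : ∀ a : ℝ, IntegrableOn (fun t : ℝ => Real.cos (a * t)) (Set.Icc (0 : ℝ) (2 / ε)) :=
    fun a => Continuous.integrableOn_Icc (by fun_prop)
  have hsum : ∀ t : ℝ, (∑ j : Fin N, ∑ k : Fin N,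
      Real.cos ((hH.eigenvalues j - hH.eigenvalues k) * t)) = ∑ p : Fin N × Fin N,
      Real.cos ((hH.eigenvalues p.1 - hH.eigenvalues p.2) * t) := fun t => by
    rw [Fintype.sum_prod_type]
  simp_rw [hsum]
  rw [integral_const_mul, integral_finsetSum _ (fun p _ => hint _)]
  have key := Finset.sum_le_sum (s := (Finset.univ : Finset (Fin N × Fin N)))
    (fun p _ => avg_cos_le ε (hH.eigenvalues p.1 - hH.eigenvalues p.2) hε)
  rw [← Finset.mul_sum, Finset.sum_sub_distrib, ← Finset.sum_filter] at key
  simp only [Finset.sum_const, nsmul_eq_mul, Finset.card_univ, Fintype.card_prod,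
    Fintype.card_fin, Nat.cast_mul, mul_one] at key
  set S := ∑ p : Fin N × Fin N, ∫ t in Set.Icc (0 : ℝ) (2 / ε),
    Real.cos ((hH.eigenvalues p.1 - hH.eigenvalues p.2) * t) with hS
  have k2 : S ≤ (2 / ε) * ((N : ℝ) ^ 2 * (1 - d / 2)) := by
    refine key.trans ?_
    gcongr
    nlinarith [hgap]
  calc ε / 2 * (1 / (N : ℝ) ^ 2 * S)
      ≤ ε / 2 * (1 / (N : ℝ) ^ 2 * ((2 / ε) * ((N : ℝ) ^ 2 * (1 - d / 2)))) := by gcongr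
    _ = 1 - d / 2 := by field_simp
end

section
/- Let n ≥ 1 and 1 ≤ k ≤ n, and let α : {0,1}^n → ℝ be a family of real coefficients with α_p = 0 whenever p = 0 or the Hamming weight |p| exceeds k. Define f : {0,1}^n → ℝ by f(s) = Σ_{p} α_p · (−1)^{s·p}, where s·p = Σ_j s_j p_j mod 2. Then the number of ordered pairs (s,t) ∈ {0,1}^n × {0,1}^n satisfying |f(s) − f(t)| ≥ (Σ_p α_p²)^{1/2} is at least (1/4) · 9^{−k} · 4^n. (Equivalently: the eigenvalues of the Z-diagonal k-local traceless Hamiltonian H = Σ_p α_p P_p are exactly the values f(s), ‖H‖_F² = Σ_p α_p², and the proportion of eigenvalue pairs separated by at least ‖H‖_F is Λ(H, ‖H‖_F) ≥ 9^{−k}/4.) -/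
open Classical

/-- The character `(-1)^{s·p}` as a product. -/
noncomputable def zchi (n : ℕ) (s p : Fin n → Bool) : ℝ :=
  ∏ j, if s j = true ∧ p j = true then (-1 : ℝ) else 1

/-- The function with Fourier coefficients `α`. -/
noncomputable def zF (n : ℕ) (α : (Fin n → Bool) → ℝ) (s : Fin n → Bool) : ℝ :=
  ∑ p, α p * zchi n s p

/-- Hamming weight factor `3^{|p|}` as a product. -/
noncomputable def zW (n : ℕ) (p : Fin n → Bool) : ℝ :=
  ∏ j, if p j = true then (3 : ℝ) else 1

theorem zsum_succ (n : ℕ) (g : (Fin (n + 1) → Bool) → ℝ) :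
    ∑ s, g s = ∑ s : Fin n → Bool,
      (g (Fin.cons false s : Fin (n + 1) → Bool) + g (Fin.cons true s : Fin (n + 1) → Bool)) := by
  rw [← (Fin.consEquiv (fun _ : Fin (n + 1) => Bool)).sum_comp, Fintype.sum_prod_type,
    Fintype.sum_bool, Finset.sum_add_distrib, add_comm]
  rfl

theorem zF_false (n : ℕ) (α : (Fin (n + 1) → Bool) → ℝ) (s : Fin n → Bool) :
    zF (n + 1) α (Fin.cons false s : Fin (n + 1) → Bool) =
      zF n (fun p => α (Fin.cons false p : Fin (n + 1) → Bool)) s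
      + zF n (fun p => α (Fin.cons true p : Fin (n + 1) → Bool)) s := by
  simp [zF, zsum_succ, zchi, Fin.prod_univ_succ, Finset.sum_add_distrib]

theorem zF_true (n : ℕ) (α : (Fin (n + 1) → Bool) → ℝ) (s : Fin n → Bool) :
    zF (n + 1) α (Fin.cons true s : Fin (n + 1) → Bool) =
      zF n (fun p => α (Fin.cons false p : Fin (n + 1) → Bool)) s
      - zF n (fun p => α (Fin.cons true p : Fin (n + 1) → Bool)) s := by
  simp [zF, zsum_succ, zchi, Fin.prod_univ_succ, Finset.sum_add_distrib, sub_eq_add_neg]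

theorem zmean (n : ℕ) (α : (Fin n → Bool) → ℝ) :
    ∑ s, zF n α s = 2 ^ n * α (fun _ => false) := by
  induction n with
  | zero =>
    simp [zF, zchi]
    congr 1
    exact Subsingleton.elim _ _
  | succ n ih =>
    rw [zsum_succ]
    simp only [zF_false, zF_true]
    have h : (Fin.cons false (fun _ => false) : Fin (n + 1) → Bool) = fun _ => false := by
      funext j
      refine Fin.cases ?_ ?_ j <;> simp
    have := ih (fun p => α (Fin.cons false p : Fin (n + 1) → Bool))
    simp only [h] at this
    rw [pow_succ, mul_right_comm, ← this, Finset.sum_mul]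
    refine Finset.sum_congr rfl fun s _ => ?_
    ring

theorem zparseval (n : ℕ) (α : (Fin n → Bool) → ℝ) :
    ∑ s, (zF n α s) ^ 2 = 2 ^ n * ∑ p, (α p) ^ 2 := by
  induction n with
  | zero => simp [zF, zchi]
  | succ n ih =>
    rw [zsum_succ, zsum_succ]
    simp only [zF_false, zF_true]
    have h0 := ih (fun p => α (Fin.cons false p : Fin (n + 1) → Bool))
    have h1 := ih (fun p => α (Fin.cons true p : Fin (n + 1) → Bool))
    rw [Finset.sum_add_distrib (s := Finset.univ) (f := fun p : Fin n → Bool =>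
      α (Fin.cons false p : Fin (n + 1) → Bool) ^ 2), pow_succ, mul_right_comm, mul_add,
      ← h0, ← h1, ← Finset.sum_add_distrib, Finset.sum_mul]
    refine Finset.sum_congr rfl fun s _ => ?_
    ring

theorem zbonami (n : ℕ) (α : (Fin n → Bool) → ℝ) :
    ∑ s, (zF n α s) ^ 4 ≤ 2 ^ n * (∑ p, zW n p * (α p) ^ 2) ^ 2 := by
  induction n with
  | zero =>
    simp [zF, zchi, zW]
    apply le_of_eq
    ring
  | succ n ih =>
    rw [zsum_succ, zsum_succ]
    simp only [zF_false, zF_true]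
    have h0 := ih (fun p => α (Fin.cons false p : Fin (n + 1) → Bool))
    have h1 := ih (fun p => α (Fin.cons true p : Fin (n + 1) → Bool))
    set g := zF n (fun p => α (Fin.cons false p : Fin (n + 1) → Bool))
    set h := zF n (fun p => α (Fin.cons true p : Fin (n + 1) → Bool))
    set G := ∑ p, zW n p * (α (Fin.cons false p : Fin (n + 1) → Bool)) ^ 2 with hG
    set H := ∑ p, zW n p * (α (Fin.cons true p : Fin (n + 1) → Bool)) ^ 2 with hH
    have hW : ∀ p, 0 ≤ zW n p := fun p => Finset.prod_nonneg fun j _ => by split_ifs <;> norm_num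
    have hG0 : 0 ≤ G := Finset.sum_nonneg fun p _ => mul_nonneg (hW p) (sq_nonneg _)
    have hH0 : 0 ≤ H := Finset.sum_nonneg fun p _ => mul_nonneg (hW p) (sq_nonneg _)
    have e : ∑ p : Fin n → Bool, (zW (n + 1) (Fin.cons false p : Fin (n + 1) → Bool) *
        α (Fin.cons false p : Fin (n + 1) → Bool) ^ 2 +
        zW (n + 1) (Fin.cons true p : Fin (n + 1) → Bool) *
        α (Fin.cons true p : Fin (n + 1) → Bool) ^ 2) = G + 3 * H := by
      rw [Finset.sum_add_distrib, hG, hH, Finset.mul_sum]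
      congr 1
      · simp [zW, Fin.prod_univ_succ]
      · simp [zW, Fin.prod_univ_succ, mul_assoc]
    rw [e]
    have cs := Finset.sum_mul_sq_le_sq_mul_sq Finset.univ (fun s => g s ^ 2) (fun s => h s ^ 2)
    have cs2 : ∑ s, g s ^ 2 * h s ^ 2 ≤ 2 ^ n * (G * H) := by
      refine (le_abs_self _).trans (abs_le_of_sq_le_sq ?_ (by positivity))
      refine cs.trans ?_
      simp only [← pow_mul]
      calc _ ≤ (2 ^ n * G ^ 2) * (2 ^ n * H ^ 2) := by
            apply mul_le_mul h0 h1 (Finset.sum_nonneg fun s _ => by positivity) (by positivity)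
        _ = _ := by ring
    have e2 : ∑ s, ((g s + h s) ^ 4 + (g s - h s) ^ 4) =
        2 * ∑ s, g s ^ 4 + 12 * ∑ s, g s ^ 2 * h s ^ 2 + 2 * ∑ s, h s ^ 4 := by
      simp only [Finset.mul_sum, ← Finset.sum_add_distrib]
      refine Finset.sum_congr rfl fun s _ => ?_
      ring
    rw [e2, pow_succ]
    have : 0 ≤ (2 : ℝ) ^ n * H ^ 2 := by positivity
    nlinarith

theorem zpair (n : ℕ) (f : (Fin n → Bool) → ℝ) (hf : ∑ s, f s = 0) :
    ∑ st : (Fin n → Bool) × (Fin n → Bool), (f st.1 - f st.2) ^ 2 =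
      2 * (2 ^ n * ∑ s, f s ^ 2) := by
  have e : ∀ st : (Fin n → Bool) × (Fin n → Bool), (f st.1 - f st.2) ^ 2 =
    f st.1 ^ 2 + f st.2 ^ 2 - 2 * (f st.1 * f st.2) := fun st => by ring
  simp only [e, Finset.sum_sub_distrib, Finset.sum_add_distrib, Fintype.sum_prod_type,
    ← Finset.mul_sum, hf]
  simp [← Finset.mul_sum]
  ring

theorem zpair4 (n : ℕ) (f : (Fin n → Bool) → ℝ) (hf : ∑ s, f s = 0) :
    ∑ st : (Fin n → Bool) × (Fin n → Bool), (f st.1 - f st.2) ^ 4 =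
      2 * (2 ^ n * ∑ s, f s ^ 4) + 6 * (∑ s, f s ^ 2) ^ 2 := by
  have e : ∀ st : (Fin n → Bool) × (Fin n → Bool), (f st.1 - f st.2) ^ 4 =
    f st.1 ^ 4 + f st.2 ^ 4 - 4 * (f st.1 ^ 3 * f st.2) - 4 * (f st.1 * f st.2 ^ 3)
      + 6 * (f st.1 ^ 2 * f st.2 ^ 2) := fun st => by ring
  simp only [e, Finset.sum_sub_distrib, Finset.sum_add_distrib, Fintype.sum_prod_type,
    ← Finset.mul_sum, ← Finset.sum_mul, hf]
  simp [← Finset.mul_sum]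
  ring

/-- **Eigenvalue-gap bound for Z-diagonal `k`-local Hamiltonians.**
Let `f(s) = ∑_p α_p (−1)^{s·p}` with `α_0 = 0` and `α_p = 0` for Hamming weight
`|p| > k` (the eigenvalue function of a `Z`-diagonal `k`-local traceless
Hamiltonian, whose normalized Frobenius norm squared is `∑_p α_p²`).
Then the number of ordered pairs `(s,t)` of bit strings with
`|f(s) − f(t)| ≥ (∑_p α_p²)^{1/2}` is at least `(1/4)·9^{−k}·4^n`. -/
theorem zdiag_eigenvalue_gap_bound
    (n k : ℕ) (hn : 1 ≤ n) (hk1 : 1 ≤ k) (hkn : k ≤ n)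
    (α : (Fin n → Bool) → ℝ)
    (hzero : α (fun _ => false) = 0)
    (hloc : ∀ p : Fin n → Bool,
      k < (Finset.univ.filter (fun j => p j = true)).card → α p = 0) :
    (1 / 4 : ℝ) * 4 ^ n / 9 ^ k ≤
      ((Finset.univ.filter (fun st : (Fin n → Bool) × (Fin n → Bool) =>
        Real.sqrt (∑ p, (α p) ^ 2) ≤
          |(∑ p, α p * (-1 : ℝ) ^
              (Finset.univ.filter (fun j => st.1 j = true ∧ p j = true)).card) -
           (∑ p, α p * (-1 : ℝ) ^
              (Finset.univ.filter (fun j => st.2 j = true ∧ p j = true)).card)|)).card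
        : ℝ) := by
  have hchi : ∀ s p : Fin n → Bool, (-1 : ℝ) ^
      (Finset.univ.filter (fun j => s j = true ∧ p j = true)).card = zchi n s p := by
    intro s p
    rw [zchi, Finset.prod_ite]
    simp
  simp only [hchi]
  change _ ≤ ((Finset.univ.filter (fun st : (Fin n → Bool) × (Fin n → Bool) =>
        Real.sqrt (∑ p, (α p) ^ 2) ≤ |zF n α st.1 - zF n α st.2|)).card : ℝ)
  set f := zF n α with hfdef
  set V := ∑ p, (α p) ^ 2 with hV
  have hV0 : 0 ≤ V := Finset.sum_nonneg fun p _ => sq_nonneg _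
  have hmean : ∑ s, f s = 0 := by rw [hfdef, zmean, hzero, mul_zero]
  have hpar : ∑ s, f s ^ 2 = 2 ^ n * V := zparseval n α
  have hWle : ∑ p, zW n p * (α p) ^ 2 ≤ 3 ^ k * V := by
    rw [hV, Finset.mul_sum]
    refine Finset.sum_le_sum fun p _ => ?_
    by_cases hp : k < (Finset.univ.filter (fun j => p j = true)).card
    · simp [hloc p hp]
    · refine mul_le_mul_of_nonneg_right ?_ (sq_nonneg _)
      have : zW n p = 3 ^ (Finset.univ.filter (fun j => p j = true)).card := by
        rw [zW, Finset.prod_ite]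
        simp
      rw [this]
      exact pow_le_pow_right₀ (by norm_num) (not_lt.mp hp)
  have hW0 : 0 ≤ ∑ p, zW n p * (α p) ^ 2 := Finset.sum_nonneg fun p _ =>
    mul_nonneg (Finset.prod_nonneg fun j _ => by split_ifs <;> norm_num) (sq_nonneg _)
  have h4 : ∑ s, f s ^ 4 ≤ 2 ^ n * (9 ^ k * V ^ 2) := by
    refine (zbonami n α).trans (mul_le_mul_of_nonneg_left ?_ (by positivity))
    calc _ ≤ (3 ^ k * V) ^ 2 := pow_le_pow_left₀ hW0 hWle 2
      _ = _ := by rw [mul_pow, ← pow_mul, mul_comm k 2, pow_mul]; norm_num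
  have p2 := zpair n f hmean
  have p4 := zpair4 n f hmean
  rw [hpar] at p2 p4
  have h44 : (4 : ℝ) ^ n = 2 ^ n * 2 ^ n := by rw [← mul_pow]; norm_num
  have h9 : (9 : ℝ) ≤ 9 ^ k := by
    calc (9 : ℝ) = 9 ^ 1 := by norm_num
      _ ≤ 9 ^ k := pow_le_pow_right₀ (by norm_num) hk1
  have hN : (0 : ℝ) < 4 ^ n := by positivity
  have q4 : ∑ st : (Fin n → Bool) × (Fin n → Bool), (f st.1 - f st.2) ^ 4 ≤
      4 ^ n * (4 * 9 ^ k * V ^ 2) := by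
    rw [p4]
    have a := mul_le_mul_of_nonneg_left h4 (by positivity : (0 : ℝ) ≤ 2 ^ n)
    have b := mul_le_mul_of_nonneg_right h9 (by positivity : (0 : ℝ) ≤ 4 ^ n * V ^ 2)
    have c : (0 : ℝ) ≤ 4 ^ n * V ^ 2 := by positivity
    rw [h44] at *
    nlinarith
  set S := Finset.univ.filter (fun st : (Fin n → Bool) × (Fin n → Bool) =>
        Real.sqrt V ≤ |f st.1 - f st.2|) with hS
  have hcard : ((Finset.univ : Finset ((Fin n → Bool) × (Fin n → Bool))).card : ℝ) = 4 ^ n := by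
    simp [h44]
  rw [div_le_iff₀ (by positivity)]
  rcases hV0.eq_or_lt with hz | hpos
  · have : S = Finset.univ := by
      rw [hS, ← hz]
      simp
    rw [this, hcard]
    nlinarith
  · have hlow : 4 ^ n * V ≤ ∑ st ∈ S, (f st.1 - f st.2) ^ 2 := by
      have hsplit : ∑ st : (Fin n → Bool) × (Fin n → Bool), (f st.1 - f st.2) ^ 2 ≤
          ∑ st : (Fin n → Bool) × (Fin n → Bool),
            (V + if Real.sqrt V ≤ |f st.1 - f st.2| then (f st.1 - f st.2) ^ 2 else 0) := by
        refine Finset.sum_le_sum fun st _ => ?_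
        split_ifs with h
        · linarith
        · have := (Real.lt_sqrt (abs_nonneg _)).mp (not_le.mp h)
          rw [sq_abs] at this
          linarith
      rw [Finset.sum_add_distrib, ← Finset.sum_filter, Finset.sum_const, nsmul_eq_mul, hcard,
        p2] at hsplit
      rw [h44] at *
      linarith
    have cs := Finset.sum_mul_sq_le_sq_mul_sq S (fun _ => (1 : ℝ))
      (fun st => (f st.1 - f st.2) ^ 2)
    simp only [one_mul, one_pow, Finset.sum_const, nsmul_eq_mul, mul_one, ← pow_mul] at cs
    have hsub : ∑ st ∈ S, (f st.1 - f st.2) ^ (2 * 2) ≤ 4 ^ n * (4 * 9 ^ k * V ^ 2) := by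
      refine le_trans (Finset.sum_le_sum_of_subset_of_nonneg (Finset.subset_univ _) ?_) q4
      intro st _ _
      exact Even.pow_nonneg (by decide) _
    have h1 : (4 ^ n * V) ^ 2 ≤ (S.card : ℝ) * (4 ^ n * (4 * 9 ^ k * V ^ 2)) :=
      (pow_le_pow_left₀ (by positivity) hlow 2).trans
        (cs.trans (mul_le_mul_of_nonneg_left hsub (by positivity)))
    have h2 : (4 ^ n * V ^ 2) * 4 ^ n ≤ (4 ^ n * V ^ 2) * (S.card * (4 * 9 ^ k)) := by
      calc _ = (4 ^ n * V) ^ 2 := by ring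
        _ ≤ _ := h1
        _ = _ := by ring
    have h3 := le_of_mul_le_mul_left h2 (by positivity)
    linarith
end

section
/- Let n ≥ 1 and 1 ≤ k ≤ n, and let α : {0,1,2,3}^n → ℝ satisfy α_p = 0 whenever the weight |p| := #{j : p_j ≠ 0} exceeds k. For q ∈ {1,2,3}^n define Y(q) = Σ_{p : ∀j, p_j = 0 ∨ p_j = q_j} α_p². Then the number of q ∈ {1,2,3}^n with Y(q) ≥ (Σ_p α_p²)/(2·3^k) is at least 3^n/(4·3^k). (Equivalently: for a k-local traceless Hamiltonian H with Pauli coefficients α_p, a uniformly random choice of single-qubit Pauli bases Q^{(1)},…,Q^{(n)} ∈ {X,Y,Z} yields an effective diagonal Hamiltonian H_eff with ‖H_eff‖_F ≥ ‖H‖_F/(√2·3^{k/2}) with probability at least 1/(4·3^k).) -/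
open Classical

theorem rdbs_count (n : ℕ) (p : Fin n → Fin 4) :
    3 ^ (Finset.univ.filter (fun j => p j ≠ 0)).card *
      (Finset.univ.filter (fun q : Fin n → Fin 3 =>
        ∀ j, p j = 0 ∨ p j = (q j).succ)).card = 3 ^ n := by
  have h1 : (Finset.univ.filter (fun q : Fin n → Fin 3 =>
        ∀ j, p j = 0 ∨ p j = (q j).succ)) =
      Fintype.piFinset (fun j => Finset.univ.filter
        (fun x : Fin 3 => p j = 0 ∨ p j = x.succ)) := by
    ext q
    simp [Fintype.mem_piFinset]
  have h2 : ∀ a : Fin 4, (if a ≠ 0 then 3 else 1) *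
      (Finset.univ.filter (fun x : Fin 3 => a = 0 ∨ a = x.succ)).card = 3 := by
    intro a
    refine Fin.cases ?_ (fun b => ?_) a
    · simp
    · simp [Fin.succ_ne_zero, Finset.filter_eq]
  have h3 : 3 ^ (Finset.univ.filter (fun j => p j ≠ 0)).card =
      ∏ j : Fin n, (if p j ≠ 0 then 3 else 1) := by
    rw [← Finset.prod_filter, Finset.prod_const]
  rw [h1, Fintype.card_piFinset, h3, ← Finset.prod_mul_distrib,
    Finset.prod_congr rfl (fun j _ => h2 (p j))]
  simp

/-- **Randomized diagonal basis selection.**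
Pauli strings are indexed by `p ∈ {0,1,2,3}^n` (`0 ↦ I`, `1 ↦ X`, `2 ↦ Y`, `3 ↦ Z`)
with weight `|p| = #{j : p_j ≠ 0}`; suppose `α_p = 0` whenever `|p| > k`.
For a choice of local bases `q ∈ {1,2,3}^n`, the surviving mass is
`Y(q) = ∑_{p : ∀ j, p_j = 0 ∨ p_j = q_j} α_p²` (the squared normalized Frobenius
norm of the effective diagonal Hamiltonian). Then the number of `q` with
`Y(q) ≥ (∑_p α_p²)/(2·3^k)` is at least `3^n/(4·3^k)`. -/
theorem randomized_diagonal_basis_selection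
    (n k : ℕ) (hn : 1 ≤ n) (hk1 : 1 ≤ k) (hkn : k ≤ n)
    (α : (Fin n → Fin 4) → ℝ)
    (hloc : ∀ p : Fin n → Fin 4,
      k < (Finset.univ.filter (fun j => p j ≠ 0)).card → α p = 0) :
    (3 : ℝ) ^ n / (4 * 3 ^ k) ≤
      ((Finset.univ.filter (fun q : Fin n → Fin 3 =>
        (∑ p, (α p) ^ 2) / (2 * 3 ^ k) ≤
          ∑ p ∈ Finset.univ.filter
              (fun p : Fin n → Fin 4 => ∀ j, p j = 0 ∨ p j = (q j).succ),
            (α p) ^ 2)).card : ℝ) := by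
  set S : ℝ := ∑ p, (α p) ^ 2 with hS
  set Y : (Fin n → Fin 3) → ℝ := fun q => ∑ p ∈ Finset.univ.filter
              (fun p : Fin n → Fin 4 => ∀ j, p j = 0 ∨ p j = (q j).succ),
            (α p) ^ 2 with hY
  change _ ≤ ((Finset.univ.filter (fun q => S / (2 * 3 ^ k) ≤ Y q)).card : ℝ)
  have hS0 : 0 ≤ S := Finset.sum_nonneg (fun p _ => sq_nonneg _)
  have hY0 : ∀ q, 0 ≤ Y q := fun q => Finset.sum_nonneg (fun p _ => sq_nonneg _)
  have hYS : ∀ q, Y q ≤ S := fun q =>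
    Finset.sum_le_sum_of_subset_of_nonneg (Finset.filter_subset _ _)
      (fun p _ _ => sq_nonneg _)
  have h3k : (1 : ℝ) ≤ 3 ^ k := one_le_pow₀ (by norm_num)
  have h3n : (0 : ℝ) < 3 ^ n := by positivity
  have hsum : S * 3 ^ n ≤ 3 ^ k * ∑ q, Y q := by
    have e : ∑ q, Y q = ∑ p : Fin n → Fin 4, (α p) ^ 2 *
        ((Finset.univ.filter (fun q : Fin n → Fin 3 =>
          ∀ j, p j = 0 ∨ p j = (q j).succ)).card : ℝ) := by
      simp only [hY, Finset.sum_filter]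
      rw [Finset.sum_comm]
      refine Finset.sum_congr rfl (fun p _ => ?_)
      rw [← Finset.sum_filter, Finset.sum_const, nsmul_eq_mul, mul_comm]
    rw [e, hS, Finset.sum_mul, Finset.mul_sum]
    refine Finset.sum_le_sum (fun p _ => ?_)
    by_cases hp : k < (Finset.univ.filter (fun j => p j ≠ 0)).card
    · simp [hloc p hp]
    · have hc := rdbs_count n p
      have hle : 3 ^ n ≤ 3 ^ k * (Finset.univ.filter (fun q : Fin n → Fin 3 =>
          ∀ j, p j = 0 ∨ p j = (q j).succ)).card := by
        rw [← hc]
        exact Nat.mul_le_mul_right _ (Nat.pow_le_pow_right (by norm_num) (not_lt.mp hp))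
      have hle' : (3 : ℝ) ^ n ≤ 3 ^ k * ((Finset.univ.filter (fun q : Fin n → Fin 3 =>
          ∀ j, p j = 0 ∨ p j = (q j).succ)).card : ℝ) := by exact_mod_cast hle
      calc _ ≤ (α p) ^ 2 * _ := mul_le_mul_of_nonneg_left hle' (sq_nonneg _)
        _ = _ := by ring
  rcases hS0.eq_or_lt with h0 | hpos
  · rw [← h0]
    have : (Finset.univ.filter (fun q => (0 : ℝ) / (2 * 3 ^ k) ≤ Y q)) = Finset.univ := by
      ext q
      simp [hY0 q]
    rw [this]
    simp only [Finset.card_univ, Fintype.card_fun, Fintype.card_fin]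
    push_cast
    exact div_le_self h3n.le (by linarith)
  · set c : ℝ := ((Finset.univ.filter (fun q => S / (2 * 3 ^ k) ≤ Y q)).card : ℝ) with hc
    have hub : ∑ q, Y q ≤ c * S + 3 ^ n * (S / (2 * 3 ^ k)) := by
      have : ∀ q, Y q ≤ (if S / (2 * 3 ^ k) ≤ Y q then S else 0) + S / (2 * 3 ^ k) := by
        intro q
        have : 0 ≤ S / (2 * 3 ^ k) := by positivity
        split_ifs with h
        · linarith [hYS q]
        · linarith [not_le.mp h]
      refine (Finset.sum_le_sum (fun q _ => this q)).trans (le_of_eq ?_)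
      rw [Finset.sum_add_distrib, ← Finset.sum_filter]
      simp [hc]
    have h4 : S * 3 ^ n ≤ S * (3 ^ k * c + 3 ^ n / 2) := by
      refine hsum.trans ((mul_le_mul_of_nonneg_left hub (by positivity)).trans (le_of_eq ?_))
      field_simp
    have h5 := le_of_mul_le_mul_left h4 hpos
    rw [div_le_iff₀ (by positivity)]
    linarith
end

section
/- Let n ≥ 1 and 1 ≤ k ≤ n, and let α : {0,1,2,3}^n → ℝ satisfy α_p = 0 whenever the weight |p| := #{j : p_j ≠ 0} exceeds k. For q ∈ {1,2,3}^n define Y(q) = Σ_{p : ∀j, p_j = 0 ∨ p_j = q_j} α_p². Then the expectation of Y over uniformly random q satisfies (1/3^n)·Σ_{q ∈ {1,2,3}^n} Y(q) = Σ_p α_p² · 3^{−|p|}, and consequently (1/3^n)·Σ_q Y(q) ≥ 3^{−k} · Σ_p α_p². -/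
open Classical

/-- Number of bases `q` for which a fixed Pauli string survives. -/
theorem survive_count (n : ℕ) (p : Fin n → Fin 4) :
    ∑ q : Fin n → Fin 3, (if ∀ j, p j = 0 ∨ p j = (q j).succ then (1 : ℝ) else 0)
      = 3 ^ n / 3 ^ (Finset.univ.filter (fun j => p j ≠ 0)).card := by
  have h1 : ∀ q : Fin n → Fin 3,
      (if ∀ j, p j = 0 ∨ p j = (q j).succ then (1 : ℝ) else 0)
        = ∏ j, (if p j = 0 ∨ p j = (q j).succ then (1 : ℝ) else 0) := by
    intro q
    rw [Finset.prod_ite_zero]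
    simp
  have h2 : ∀ a : Fin 4, ∑ b : Fin 3, (if a = 0 ∨ a = b.succ then (1 : ℝ) else 0)
      = 3 / (if a ≠ 0 then 3 else 1) := by
    intro a
    refine Fin.cases ?_ (fun c => ?_) a
    · simp
    · simp [Fin.succ_ne_zero]
  rw [Finset.sum_congr rfl (fun q _ => h1 q)]
  rw [← Fintype.prod_sum (fun j (b : Fin 3) =>
    (if p j = 0 ∨ p j = b.succ then (1 : ℝ) else 0))]
  rw [Finset.prod_congr rfl (fun j _ => h2 (p j)), Finset.prod_div_distrib,
    ← Finset.prod_filter]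
  simp

/-- **First moment of the surviving Frobenius mass under random basis choice.**
With Pauli strings `p ∈ {0,1,2,3}^n`, weight `|p| = #{j : p_j ≠ 0}`, `α_p = 0` for
`|p| > k`, and `Y(q) = ∑_{p : ∀ j, p_j = 0 ∨ p_j = q_j} α_p²` for `q ∈ {1,2,3}^n`,
the expectation over uniform `q` satisfies
`E[Y] = ∑_p α_p² 3^{−|p|} ≥ 3^{−k} ∑_p α_p²`. -/
theorem surviving_mass_first_moment
    (n k : ℕ) (hn : 1 ≤ n) (hk1 : 1 ≤ k) (hkn : k ≤ n)
    (α : (Fin n → Fin 4) → ℝ)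
    (hloc : ∀ p : Fin n → Fin 4,
      k < (Finset.univ.filter (fun j => p j ≠ 0)).card → α p = 0) :
    ((1 / 3 ^ n : ℝ) * ∑ q : Fin n → Fin 3,
        ∑ p ∈ Finset.univ.filter
            (fun p : Fin n → Fin 4 => ∀ j, p j = 0 ∨ p j = (q j).succ),
          (α p) ^ 2
      = ∑ p : Fin n → Fin 4,
          (α p) ^ 2 / 3 ^ (Finset.univ.filter (fun j => p j ≠ 0)).card) ∧
    ((∑ p : Fin n → Fin 4, (α p) ^ 2) / 3 ^ k ≤
      (1 / 3 ^ n : ℝ) * ∑ q : Fin n → Fin 3,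
        ∑ p ∈ Finset.univ.filter
            (fun p : Fin n → Fin 4 => ∀ j, p j = 0 ∨ p j = (q j).succ),
          (α p) ^ 2) := by
  have key : (1 / 3 ^ n : ℝ) * ∑ q : Fin n → Fin 3,
        ∑ p ∈ Finset.univ.filter
            (fun p : Fin n → Fin 4 => ∀ j, p j = 0 ∨ p j = (q j).succ),
          (α p) ^ 2
      = ∑ p : Fin n → Fin 4,
          (α p) ^ 2 / 3 ^ (Finset.univ.filter (fun j => p j ≠ 0)).card := by
    simp_rw [Finset.sum_filter]
    rw [Finset.sum_comm, Finset.mul_sum]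
    refine Finset.sum_congr rfl fun p _ => ?_
    have h : ∑ q : Fin n → Fin 3, (if ∀ j, p j = 0 ∨ p j = (q j).succ then (α p) ^ 2 else 0)
        = (α p) ^ 2 * (3 ^ n / 3 ^ (Finset.univ.filter (fun j => p j ≠ 0)).card) := by
      rw [← survive_count, Finset.mul_sum]
      simp only [mul_ite, mul_one, mul_zero]
    rw [h]
    field_simp
  refine ⟨key, ?_⟩
  rw [key, Finset.sum_div]
  refine Finset.sum_le_sum fun p _ => ?_
  by_cases hp : k < (Finset.univ.filter (fun j => p j ≠ 0)).card
  · simp [hloc p hp]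
  · push Not at hp
    exact div_le_div_of_nonneg_left (sq_nonneg _) (by positivity)
      (pow_le_pow_right₀ (by norm_num) hp)
end

section
/- Let n ≥ 1 and 1 ≤ k ≤ n, and let α : {0,1,2,3}^n → ℝ satisfy α_p = 0 whenever the weight |p| := #{j : p_j ≠ 0} exceeds k. For q ∈ {1,2,3}^n define Y(q) = Σ_{p : ∀j, p_j = 0 ∨ p_j = q_j} α_p². Then the second moment of Y over uniformly random q is controlled by the square of its first moment: (1/3^n)·Σ_{q ∈ {1,2,3}^n} Y(q)² ≤ 3^k · ( (1/3^n)·Σ_q Y(q) )². -/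
open Classical

theorem count_aux (n k : ℕ) (p : Fin n → Fin 4)
    (hp : (Finset.univ.filter (fun j => p j ≠ 0)).card ≤ k) :
    3 ^ n ≤ 3 ^ k * (Finset.univ.filter
      (fun q : Fin n → Fin 3 => ∀ j, p j = 0 ∨ p j = (q j).succ)).card := by
  have h1 : (Finset.univ.filter
      (fun q : Fin n → Fin 3 => ∀ j, p j = 0 ∨ p j = (q j).succ)) =
      Fintype.piFinset (fun j => Finset.univ.filter
        (fun x : Fin 3 => p j = 0 ∨ p j = x.succ)) := by
    ext q
    simp [Fintype.mem_piFinset]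
  have h3 : ∀ a : Fin 4, 3 ≤ (if a ≠ 0 then 3 else 1) *
      (Finset.univ.filter (fun x : Fin 3 => a = 0 ∨ a = x.succ)).card := by
    intro a
    by_cases ha : a = 0
    · simp [ha]
    · obtain ⟨b, rfl⟩ := Fin.exists_succ_eq.mpr ha
      have : 0 < (Finset.univ.filter
          (fun x : Fin 3 => b.succ = 0 ∨ b.succ = x.succ)).card :=
        Finset.card_pos.mpr ⟨b, by simp⟩
      rw [if_pos ha]
      omega
  rw [h1, Fintype.card_piFinset]
  calc 3 ^ n = ∏ j : Fin n, 3 := by simp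
    _ ≤ ∏ j : Fin n, ((if p j ≠ 0 then 3 else 1) *
      (Finset.univ.filter (fun x : Fin 3 => p j = 0 ∨ p j = x.succ)).card) :=
        Finset.prod_le_prod' (fun j _ => h3 (p j))
    _ = 3 ^ (Finset.univ.filter (fun j => p j ≠ 0)).card * ∏ j : Fin n,
      (Finset.univ.filter (fun x : Fin 3 => p j = 0 ∨ p j = x.succ)).card := by
        rw [Finset.prod_mul_distrib, ← Finset.prod_filter, Finset.prod_const]
    _ ≤ _ := Nat.mul_le_mul_right _ (Nat.pow_le_pow_right (by norm_num) hp)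

/-- **Second moment bound for the surviving Frobenius mass.**
With Pauli strings `p ∈ {0,1,2,3}^n`, weight `|p| = #{j : p_j ≠ 0}`, `α_p = 0` for
`|p| > k`, and `Y(q) = ∑_{p : ∀ j, p_j = 0 ∨ p_j = q_j} α_p²` for `q ∈ {1,2,3}^n`,
the second moment over uniform `q` satisfies `E[Y²] ≤ 3^k (E[Y])²`. -/
theorem surviving_mass_second_moment
    (n k : ℕ) (hn : 1 ≤ n) (hk1 : 1 ≤ k) (hkn : k ≤ n)
    (α : (Fin n → Fin 4) → ℝ)
    (hloc : ∀ p : Fin n → Fin 4,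
      k < (Finset.univ.filter (fun j => p j ≠ 0)).card → α p = 0) :
    (1 / 3 ^ n : ℝ) * ∑ q : Fin n → Fin 3,
        (∑ p ∈ Finset.univ.filter
            (fun p : Fin n → Fin 4 => ∀ j, p j = 0 ∨ p j = (q j).succ),
          (α p) ^ 2) ^ 2 ≤
      3 ^ k * ((1 / 3 ^ n : ℝ) * ∑ q : Fin n → Fin 3,
        ∑ p ∈ Finset.univ.filter
            (fun p : Fin n → Fin 4 => ∀ j, p j = 0 ∨ p j = (q j).succ),
          (α p) ^ 2) ^ 2 := by
  set Y : (Fin n → Fin 3) → ℝ := fun q => ∑ p ∈ Finset.univ.filter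
    (fun p : Fin n → Fin 4 => ∀ j, p j = 0 ∨ p j = (q j).succ), (α p) ^ 2 with hY
  change (1 / 3 ^ n : ℝ) * ∑ q, (Y q) ^ 2 ≤ 3 ^ k * ((1 / 3 ^ n : ℝ) * ∑ q, Y q) ^ 2
  set A : ℝ := ∑ p, (α p) ^ 2 with hA
  have hY0 : ∀ q, 0 ≤ Y q := fun q => Finset.sum_nonneg (fun p _ => sq_nonneg _)
  have hYA : ∀ q, Y q ≤ A := fun q =>
    Finset.sum_le_sum_of_subset_of_nonneg (Finset.filter_subset _ _)
      (fun p _ _ => sq_nonneg _)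
  have hS0 : 0 ≤ ∑ q, Y q := Finset.sum_nonneg (fun q _ => hY0 q)
  have h1 : ∑ q, (Y q) ^ 2 ≤ A * ∑ q, Y q := by
    rw [Finset.mul_sum]
    refine Finset.sum_le_sum (fun q _ => ?_)
    rw [sq]
    exact mul_le_mul_of_nonneg_right (hYA q) (hY0 q)
  have hS : ∑ q, Y q = ∑ p, ((Finset.univ.filter
      (fun q : Fin n → Fin 3 => ∀ j, p j = 0 ∨ p j = (q j).succ)).card : ℝ) * (α p) ^ 2 := by
    simp only [hY, Finset.sum_filter]
    rw [Finset.sum_comm]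
    refine Finset.sum_congr rfl (fun p _ => ?_)
    rw [← Finset.sum_filter, Finset.sum_const, nsmul_eq_mul]
  have h2 : 3 ^ n * A ≤ 3 ^ k * ∑ q, Y q := by
    rw [hS, hA, Finset.mul_sum, Finset.mul_sum]
    refine Finset.sum_le_sum (fun p _ => ?_)
    by_cases hp : k < (Finset.univ.filter (fun j => p j ≠ 0)).card
    · simp [hloc p hp]
    · have := count_aux n k p (not_lt.mp hp)
      rw [← mul_assoc]
      refine mul_le_mul_of_nonneg_right ?_ (sq_nonneg _)
      exact_mod_cast this
  have h3 : (0 : ℝ) < 3 ^ n := by positivity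
  calc (1 / 3 ^ n : ℝ) * ∑ q, (Y q) ^ 2 ≤ (1 / 3 ^ n : ℝ) * (A * ∑ q, Y q) :=
        mul_le_mul_of_nonneg_left h1 (by positivity)
    _ = (1 / 3 ^ n : ℝ) ^ 2 * ((3 ^ n * A) * ∑ q, Y q) := by field_simp
    _ ≤ (1 / 3 ^ n : ℝ) ^ 2 * ((3 ^ k * ∑ q, Y q) * ∑ q, Y q) :=
        mul_le_mul_of_nonneg_left (mul_le_mul_of_nonneg_right h2 hS0) (by positivity)
    _ = _ := by ring
end
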